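/- arXiv:math/0406412 — 3 statements merged into one kernel-verified Lean document; each statement's English description precedes it below -/
import Mathlib

section
/- Let k be an algebraically closed field and let A₁ and A₂ be affine domains over k with trdeg_k(A₁) = trdeg_k(A₂) = 1. If the polynomial rings A₁[x₁,…,xₙ] and A₂[x₁,…,xₙ] are isomorphic as k-algebras for some positive integer n, then A₁ and A₂ are isomorphic as k-algebras. Moreover, if f : A₁[x₁,…,xₙ] → A₂[x₁,…,xₙ] is a k-algebra isomorphism and A₁ is not isomorphic to k[X], then f restricts to a k-algebra isomorphism of A₁ onto A₂. -/
open Polynomial TensorProduct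

/-- An *exponential map* on a commutative `k`-algebra `A` is a `k`-algebra homomorphism
`φ : A → A[t]` such that evaluation at `t = 0` composed with `φ` is the identity, and
applying `φ` coefficientwise to `φ a` equals substituting `s + t` for `t` in `φ a`. -/
def IsExponential {k A : Type*} [CommRing k] [CommRing A] [Algebra k A]
    (φ : A →ₐ[k] A[X]) : Prop :=
  (∀ a : A, (φ a).eval 0 = a) ∧
  (∀ a : A, (φ a).map (φ : A →+* A[X]) =
      (φ a).eval₂ ((C : A[X] →+* A[X][X]).comp (C : A →+* A[X])) (X + C X))

/-- The ring of `φ`-invariants `A^φ = {a : A | φ a = C a}`. -/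
noncomputable def expInvariants {k A : Type*} [CommRing k] [CommRing A] [Algebra k A]
    (φ : A →ₐ[k] A[X]) : Subalgebra k A :=
  AlgHom.equalizer φ ((Algebra.ofId A A[X]).restrictScalars k)

/-- The AK invariant (ring of absolute constants) of a commutative `k`-algebra `A`:
the intersection of `A^φ` over all exponential maps `φ` on `A`. -/
noncomputable def AK (k A : Type*) [CommRing k] [CommRing A] [Algebra k A] : Subalgebra k A :=
  ⨅ φ : {ψ : A →ₐ[k] A[X] // IsExponential ψ}, expInvariants φ.1

/-- `A` has transcendence degree 1 over `k`: some single element is a transcendence basis. -/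
def TrdegOne (k A : Type*) [CommRing k] [CommRing A] [Algebra k A] : Prop :=
  ∃ x : A, IsTranscendenceBasis k (fun _ : Unit => x)

theorem TrdegOne.isAlgebraic_adjoin {k A : Type*} [Field k] [CommRing A] [IsDomain A] [Algebra k A]
    (h : TrdegOne k A) {a : A} (ha : Transcendental k a) :
    Algebra.IsAlgebraic (Algebra.adjoin k {a}) A := by
  obtain ⟨x, hx⟩ := h
  have hind : AlgebraicIndependent k (fun _ : Unit => a) :=
    algebraicIndependent_unique_type_iff.2 ha
  have hb := hind.isTranscendenceBasis_of_lift_trdeg_le_of_finite hx.lift_cardinalMk_eq_trdeg.ge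
  have := hb.isAlgebraic
  rw [Set.range_const] at this
  exact this

theorem TrdegOne.injective_of_transcendental {k A B : Type*} [Field k] [CommRing A] [IsDomain A]
    [Algebra k A] [CommRing B] [Algebra k B] (h : TrdegOne k A) (ψ : A →ₐ[k] B) {a : A}
    (ha : Transcendental k (ψ a)) : Function.Injective ψ := by
  have := h.isAlgebraic_adjoin fun h' => ha (h'.algHom ψ)
  rw [injective_iff_map_eq_zero]
  intro x hx
  by_contra hx0
  have hxa : IsAlgebraic (Algebra.adjoin k {a}) x := Algebra.IsAlgebraic.isAlgebraic x
  obtain ⟨r, hr0, y, hy⟩ := hxa.exists_nonzero_dvd (mem_nonZeroDivisors_of_ne_zero hx0)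
  obtain ⟨r, hr⟩ := r
  obtain ⟨q, rfl⟩ := (Algebra.adjoin_singleton_eq_range_aeval k a ▸ hr : r ∈ (aeval a).range)
  have hq : aeval (ψ a) q = 0 := by
    have := congrArg ψ hy
    simpa [hx, aeval_algHom_apply] using this
  have : q = 0 := by_contra fun h => ha ⟨q, h, hq⟩
  exact hr0 (by ext; simp [this])

theorem MvPolynomial.eq_C_of_isAlgebraic {σ R : Type*} [CommRing R] [IsDomain R]
    {p : MvPolynomial σ R} (hp : IsAlgebraic R p) : ∃ r, p = C r := by
  refine ⟨constantCoeff p, sub_eq_zero.1 (by_contra fun h => h ?_)⟩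
  obtain ⟨r, hr0, q, hq⟩ := (hp.sub (isAlgebraic_algebraMap (constantCoeff p))).exists_nonzero_dvd
    (mem_nonZeroDivisors_of_ne_zero h)
  rw [algebraMap_eq] at hq
  have hq0 : q ≠ 0 := by
    rintro rfl
    exact hr0 (by simpa using hq)
  have hd := congrArg totalDegree hq
  rw [totalDegree_C, totalDegree_mul_of_isDomain h hq0] at hd
  have := totalDegree_eq_zero_iff_eq_C.1 (by omega : (p - C (constantCoeff p)).totalDegree = 0)
  rw [this]
  simp [← constantCoeff_eq]

theorem exists_algHom_apply_ne_zero {k A : Type*} [Field k] [IsAlgClosed k]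
    [CommRing A] [IsDomain A] [Algebra k A] [Algebra.FiniteType k A] {d : A} (hd : d ≠ 0) :
    ∃ χ : A →ₐ[k] k, χ d ≠ 0 := by
  have := isJacobsonRing_of_finiteType (A := k) (B := A)
  have hj : d ∉ (⊥ : Ideal A).jacobson := by
    rwa [IsJacobsonRing.out inferInstance (Ideal.isPrime_bot.isRadical)]
  obtain ⟨m, ⟨-, hm⟩, hdm⟩ : ∃ m ∈ {J : Ideal A | ⊥ ≤ J ∧ J.IsMaximal}, d ∉ m := by
    simpa only [Ideal.jacobson, Ideal.mem_sInf, not_forall, exists_prop] using hj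
  let := Ideal.Quotient.field m
  have : Module.Finite k (A ⧸ m) := finite_of_finite_type_of_isJacobsonRing k (A ⧸ m)
  let e : k ≃ₐ[k] A ⧸ m := AlgEquiv.ofBijective (Algebra.ofId k (A ⧸ m))
    IsAlgClosed.algebraMap_bijective_of_isIntegral
  refine ⟨(e.symm : A ⧸ m →ₐ[k] k).comp (Ideal.Quotient.mkₐ k m), ?_⟩
  simpa [Ideal.Quotient.eq_zero_iff_mem] using hdm

theorem MvPolynomial.exists_algHom_polynomial {k σ : Type*} [Field k] [Infinite k]
    {p : MvPolynomial σ k} (hp : ∀ c, p ≠ C c) :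
    ∃ π : MvPolynomial σ k →ₐ[k] k[X], ∀ c, π p ≠ Polynomial.C c := by
  obtain ⟨u, hu⟩ : ∃ u : σ → k, eval u p ≠ eval 0 p := by
    by_contra! h
    exact hp _ (MvPolynomial.funext fun u => by rw [h u, eval_C])
  refine ⟨aeval fun i => Polynomial.C (u i) * Polynomial.X, fun c hc => hu ?_⟩
  have key (t : k) : (Polynomial.aeval t).comp
      (aeval fun i => Polynomial.C (u i) * Polynomial.X) = aeval (R := k) (t • u) := by
    ext i
    rw [AlgHom.comp_apply, aeval_X, aeval_X, map_mul, Polynomial.aeval_C, Polynomial.aeval_X,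
      mul_comm]
    rfl
  have h1 := DFunLike.congr_fun (key 1) p
  have h0 := DFunLike.congr_fun (key 0) p
  rw [AlgHom.comp_apply, hc, Polynomial.aeval_C] at h0 h1
  rw [one_smul, aeval_eq_eval] at h1
  rw [zero_smul, aeval_eq_eval] at h0
  exact h1.symm.trans h0

/-- A nonconstant polynomial over an affine domain stays nonconstant after specializing the
coefficients at a suitable closed point, avoiding the zeros of `d`, and the variables along a line. -/
theorem MvPolynomial.exists_specialization {k A σ : Type*} [Field k] [IsAlgClosed k]
    [CommRing A] [IsDomain A] [Algebra k A] [Algebra.FiniteType k A]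
    {p : MvPolynomial σ A} (hp : ∀ a, p ≠ C a) {d : A} (hd : d ≠ 0) :
    ∃ (χ : A →ₐ[k] k) (π : MvPolynomial σ A →ₐ[k] k[X]),
      (∀ a, π (C a) = Polynomial.C (χ a)) ∧ χ d ≠ 0 ∧ ∀ c, π p ≠ Polynomial.C c := by
  obtain ⟨α, hα, hα0⟩ : ∃ α, α ≠ 0 ∧ coeff α p ≠ 0 := by
    by_contra! h
    refine hp (coeff 0 p) (MvPolynomial.ext _ _ fun α => ?_)
    classical
    rw [coeff_C]
    split_ifs with h0
    · rw [h0]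
    · exact h α (Ne.symm h0)
  obtain ⟨χ, hχ⟩ := exists_algHom_apply_ne_zero (k := k) (mul_ne_zero hd hα0)
  rw [map_mul] at hχ
  obtain ⟨π, hπ⟩ := exists_algHom_polynomial (p := map χ.toRingHom p) fun c hc => by
    classical
    have := congrArg (coeff α) hc
    rw [coeff_map, coeff_C, if_neg hα.symm] at this
    exact right_ne_zero_of_mul hχ this
  refine ⟨χ, π.comp (mapAlgHom χ), fun a => ?_, left_ne_zero_of_mul hχ, hπ⟩
  have hC : mapAlgHom χ (C a : MvPolynomial σ A) = algebraMap k (MvPolynomial σ k) (χ a) :=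
    map_C _ _
  rw [AlgHom.comp_apply, hC, AlgHom.commutes, Polynomial.algebraMap_eq]

/-- `k[X]` is integral over any subalgebra containing a nonconstant polynomial. -/
theorem Polynomial.isIntegral_of_ne_C {k A : Type*} [Field k] [CommRing A] [IsDomain A]
    [Algebra k A] [Algebra A k[X]] [IsScalarTower k A k[X]] {a : A} (ha : ∀ c, algebraMap A k[X] a ≠ C c) :
    Algebra.IsIntegral A k[X] := by
  set p := algebraMap A k[X] a with hp
  have hdeg : 0 < p.natDegree := by
    by_contra! h
    exact ha _ (eq_C_of_natDegree_le_zero h)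
  have hX : IsIntegral A (X : k[X]) := by
    set c := p.leadingCoeff⁻¹
    have hmon : (p * C c).Monic := monic_mul_leadingCoeff_inv (ne_zero_of_natDegree_gt hdeg)
    have hd : (p * C c).natDegree = p.natDegree :=
      natDegree_mul_leadingCoeff_inv p (ne_zero_of_natDegree_gt hdeg)
    refine ⟨(p * C c).map (algebraMap k A) - C (c • a), ?_, ?_⟩
    · refine (hmon.map _).sub_of_left ?_
      rw [hmon.degree_map, degree_eq_natDegree hmon.ne_zero, hd]
      exact degree_C_le.trans_lt (Nat.cast_pos.2 hdeg)
    · rw [← aeval_def]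
      simp [Algebra.smul_def, ← IsScalarTower.algebraMap_apply, hp, mul_comm]
  refine ⟨fun q => ?_⟩
  have : q ∈ Algebra.adjoin k {(X : k[X])} := by simp
  induction q using Polynomial.induction_on' with
  | add p q hp hq => exact (hp (by simp)).add (hq (by simp))
  | monomial n c =>
    rw [← C_mul_X_pow_eq_monomial, ← algebraMap_eq, IsScalarTower.algebraMap_apply k A k[X]]
    exact isIntegral_algebraMap.mul (hX.pow n)

open Polynomial.Bivariate in
theorem Polynomial.Bivariate.coeff_coeff_swap {R : Type*} [CommRing R] (f : R[X][Y]) (i j : ℕ) :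
    ((swap f).coeff i).coeff j = (f.coeff j).coeff i := by
  induction f using Polynomial.induction_on' with
  | add f g hf hg => simp [hf, hg]
  | monomial n a =>
    induction a using Polynomial.induction_on' with
    | add f g hf hg => simp only [map_add, coeff_add, hf, hg]
    | monomial l a =>
      rw [swap_monomial_monomial]
      simp only [coeff_monomial]
      split_ifs <;> simp_all [coeff_monomial]

open Polynomial.Bivariate in
/-- A polynomial form of the Lüroth theorem: an integrally closed subalgebra of `k[X]` over which
`k[X]` is integral is itself a polynomial ring. It is generated by a coefficient of the minimal
polynomial of `X`. -/
theorem nonempty_algEquiv_polynomial {k A : Type*} [Field k] [CommRing A] [IsDomain A]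
    [IsIntegrallyClosed A] [Algebra k A] [Algebra A k[X]] [IsScalarTower k A k[X]]
    [FaithfulSMul A k[X]] [Algebra.IsIntegral A k[X]] : Nonempty (A ≃ₐ[k] k[X]) := by
  have hX : IsIntegral A (X : k[X]) := Algebra.IsIntegral.isIntegral _
  have hinj := FaithfulSMul.algebraMap_injective A k[X]
  set ψ := algebraMap A k[X] with hψ
  set m := minpoly A (X : k[X]) with hm
  have hmon : m.Monic := minpoly.monic hX
  obtain ⟨i, hi⟩ : ∃ i, ∀ c, ψ (m.coeff i) ≠ C c := by
    by_contra! h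
    obtain ⟨q, hq⟩ := (mem_lifts (f := (C : k →+* k[X])) (m.map ψ)).1
      ((lifts_iff_coeff_lifts _).2 fun i => by
        obtain ⟨c, hc⟩ := h i
        exact ⟨c, by rw [coeff_map, hc]⟩)
    have h0 : aeval X m = 0 := minpoly.aeval A (X : k[X])
    rw [← eval_map_algebraMap, ← hψ, ← hq] at h0
    have : q = 0 := by simpa [eval_map, ← algebraMap_eq, ← aeval_def] using h0
    apply (hmon.map ψ).ne_zero
    rw [← hq, this, Polynomial.map_zero]
  obtain ⟨c, hc0, hmonp⟩ : ∃ c : k, c ≠ 0 ∧ (ψ (c • m.coeff i)).Monic := by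
    have h0 : ψ (m.coeff i) ≠ 0 := fun h => hi 0 (by rw [h, C_0])
    refine ⟨(ψ (m.coeff i)).leadingCoeff⁻¹, inv_ne_zero (leadingCoeff_ne_zero.2 h0), ?_⟩
    rw [Algebra.smul_def, map_mul, hψ, ← IsScalarTower.algebraMap_apply, algebraMap_eq, mul_comm]
    exact monic_mul_leadingCoeff_inv h0
  set u := c • m.coeff i with hu
  set p := ψ u with hp
  have hdeg : 0 < p.natDegree := by
    by_contra! h
    obtain ⟨b, hb⟩ := natDegree_eq_zero.1 (Nat.le_zero.1 h)
    refine hi (c⁻¹ * b) ?_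
    have : m.coeff i = c⁻¹ • u := by rw [hu, smul_smul, inv_mul_cancel₀ hc0, one_smul]
    rw [this, Algebra.smul_def, map_mul, ← hp, ← hb, hψ, ← IsScalarTower.algebraMap_apply,
      algebraMap_eq, C_mul]
  let θ : k[X] →ₐ[k] A := aeval u
  -- the relation satisfied by `X` over `k[u]`
  let P : k[X][Y] := p.map C - C X
  have hPmon : P.Monic := (hmonp.map _).sub_of_left (degree_C_le.trans_lt (by
    rw [hmonp.degree_map]; exact natDegree_pos_iff_degree_pos.1 hdeg))
  have hPdeg : P.natDegree = p.natDegree := by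
    rw [natDegree_sub_C, natDegree_map_eq_of_injective C_injective]
  have hψθ : ∀ h, ψ (θ h) = h.comp p := by
    intro h
    rw [hψ, ← aeval_algebraMap_apply, comp, aeval_def, algebraMap_eq]
  have hψC (c : k) : ψ (algebraMap k A c) = C c := by
    rw [hψ, ← IsScalarTower.algebraMap_apply, algebraMap_eq]
  have hθC (c : k) : θ (C c) = algebraMap k A c := aeval_C _ _
  have hθX : θ X = u := aeval_X _
  have hmapC (h : k[X]) : (h.map C).map (θ : k[X] →+* A) = h.map (algebraMap k A) := by
    rw [Polynomial.map_map]
    congr 1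
    ext c
    exact hθC c
  have hPX : aeval (X : k[X]) (P.map (θ : k[X] →+* A)) = 0 := by
    rw [Polynomial.map_sub, hmapC, map_C, map_sub, aeval_map_algebraMap, aeval_X_left_apply, aeval_C,
      RingHom.coe_coe, hθX, sub_self]
  have hmdeg : p.natDegree ≤ m.natDegree := by
    obtain ⟨q, hq⟩ := minpoly.isIntegrallyClosed_dvd hX hPX
    have hPψ : (P.map (θ : k[X] →+* A)).map ψ = p.map C - C p := by
      have h : (C : k →+* k[X]) = ψ.comp (algebraMap k A) := RingHom.ext fun c => (hψC c).symm
      rw [Polynomial.map_sub, hmapC, Polynomial.map_sub, Polynomial.map_map, ← h, map_C, map_C,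
        RingHom.coe_coe, hθX]
    set M := swap (m.map ψ) with hM
    set Q := swap (q.map ψ) with hQ
    have hMQ : M * Q = C p - p.map C := by
      rw [hM, hQ, ← map_mul, ← Polynomial.map_mul, hm, ← hq, hPψ, map_sub, swap_C, swap_map_C]
    have hMe : p.natDegree ≤ M.natDegree := by
      refine le_natDegree_of_ne_zero fun h => ?_
      have hc := coeff_coeff_swap (m.map ψ) p.natDegree i
      rw [← hM, h, coeff_zero, coeff_map] at hc
      have : ψ (m.coeff i) = C c⁻¹ * p := by
        rw [hp, hu, Algebra.smul_def, map_mul, hψC, ← mul_assoc, ← C_mul, inv_mul_cancel₀ hc0, C_1,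
          one_mul]
      rw [this, coeff_C_mul, coeff_natDegree, hmonp.leadingCoeff, mul_one] at hc
      exact inv_ne_zero hc0 hc.symm
    have hdegMQ : (M * Q).natDegree = p.natDegree := by
      rw [hMQ, natDegree_sub, natDegree_sub_C, natDegree_map_eq_of_injective C_injective]
    have hne : M * Q ≠ 0 := ne_zero_of_natDegree_gt (hdegMQ ▸ hdeg)
    rw [natDegree_mul (left_ne_zero_of_mul hne) (right_ne_zero_of_mul hne)] at hdegMQ
    obtain ⟨r, hr⟩ := natDegree_eq_zero.1 (by omega : Q.natDegree = 0)
    have hunit : IsUnit r := by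
      have := congrArg (coeff · p.natDegree) hMQ
      simp only [← hr, coeff_mul_C, coeff_sub, coeff_map, coeff_C_of_ne_zero hdeg.ne',
        coeff_natDegree, hmonp.leadingCoeff, C_1, zero_sub] at this
      exact isUnit_of_mul_isUnit_right (this ▸ isUnit_one.neg)
    obtain ⟨e, -, rfl⟩ := isUnit_iff.1 hunit
    have hqψ : q.map ψ = C (C e) := by
      rw [← swap_swap_apply (q.map ψ), ← hQ, ← hr, swap_C_C]
    have hqd : q.natDegree = 0 := by
      rw [← natDegree_map_eq_of_injective hinj, hqψ, natDegree_C]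
    rw [← hPdeg, ← hPmon.natDegree_map (θ : k[X] →+* A), hq]
    exact natDegree_mul_le.trans (by rw [hqd, add_zero])
  refine ⟨(AlgEquiv.ofBijective θ ⟨?_, ?_⟩).symm⟩
  · rw [injective_iff_map_eq_zero]
    intro h h0
    have := hψθ h
    rw [h0, map_zero, eq_comm, comp_eq_zero_iff] at this
    refine this.resolve_right fun h => hdeg.ne' ?_
    rw [h.2, natDegree_C]
  · intro a
    set h := ψ a
    set r := h.map C %ₘ P with hr
    refine ⟨r.coeff 0, ?_⟩
    have hrX : aeval (X : k[X]) (r.map (θ : k[X] →+* A)) = h := by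
      have := congrArg (fun g => aeval (X : k[X]) (g.map (θ : k[X] →+* A)))
        (modByMonic_add_div (h.map C) P)
      simpa [hPX, hmapC, ← hr] using this
    have hrdeg : (r.map (θ : k[X] →+* A) - C a).degree < m.degree := by
      refine (degree_sub_le _ _).trans_lt (max_lt ?_ ?_)
      · refine degree_map_le.trans_lt ((degree_modByMonic_lt _ hPmon).trans_le ?_)
        rw [degree_eq_natDegree hPmon.ne_zero, degree_eq_natDegree hmon.ne_zero, hPdeg]
        exact_mod_cast hmdeg
      · rw [degree_eq_natDegree hmon.ne_zero]
        exact degree_C_le.trans_lt (by exact_mod_cast hdeg.trans_le hmdeg)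
    have h0 : r.map (θ : k[X] →+* A) - C a = 0 := by
      have : m ∣ r.map (θ : k[X] →+* A) - C a := minpoly.isIntegrallyClosed_dvd hX (by
        rw [map_sub, hrX, aeval_C, sub_self])
      by_contra hne
      exact (degree_le_of_dvd this hne).not_gt hrdeg
    have := congrArg (coeff · 0) h0
    simpa [sub_eq_zero] using this

theorem IsIntegrallyClosed.of_dvd_of_map_dvd {A B : Type*} [CommRing A] [IsDomain A]
    [CommRing B] [IsDomain B] [IsIntegrallyClosed B] (j : A →+* B) (hj : Function.Injective j)
    (h : ∀ a b : A, j b ∣ j a → b ∣ a) : IsIntegrallyClosed A := by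
  let g : FractionRing A →+* FractionRing B :=
    IsFractionRing.map (A := A) (B := B) (K := FractionRing A) (L := FractionRing B) hj
  have hg (a : A) : g (algebraMap A _ a) = algebraMap B _ (j a) := IsLocalization.map_eq _ _
  refine (isIntegrallyClosed_iff (FractionRing A)).2 fun {z} hz => ?_
  obtain ⟨a, b, hb, rfl⟩ := IsFractionRing.div_surjective (A := A) z
  have hgz : IsIntegral B (g (algebraMap A _ a / algebraMap A _ b)) :=
    hz.map_of_comp_eq j g (RingHom.ext fun a => (hg a).symm)
  obtain ⟨w, hw⟩ := IsIntegrallyClosed.isIntegral_iff.1 hgz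
  have hb0 : algebraMap A (FractionRing A) b ≠ 0 := by
    simpa using nonZeroDivisors.ne_zero hb
  have hjb0 : algebraMap B (FractionRing B) (j b) ≠ 0 := by
    rw [← hg]
    exact (map_ne_zero g).2 hb0
  rw [map_div₀, hg, hg, eq_div_iff hjb0, ← map_mul] at hw
  obtain ⟨y, rfl⟩ := h a b ⟨w, by rw [mul_comm, IsFractionRing.injective B (FractionRing B) hw]⟩
  exact ⟨y, by rw [map_mul, mul_div_cancel_left₀ _ hb0]⟩

theorem Polynomial.transcendental_of_ne_C {k : Type*} [Field k] {p : k[X]} (hp : ∀ c, p ≠ C c) :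
    Transcendental k p := by
  rintro ⟨q, hq0, hq⟩
  rw [aeval_def, algebraMap_eq, ← comp, comp_eq_zero_iff] at hq
  exact hq.elim hq0 fun h => hp _ h.2

/-- If `A₁` is not sent into `A₂`, then no maximal ideal of `A₁` extends to an ideal meeting `A₂`
nontrivially. -/
theorem exists_coeff_symm_C_notMem {k A₁ A₂ σ : Type*} [Field k] [IsAlgClosed k]
    [CommRing A₁] [IsDomain A₁] [Algebra k A₁]
    [CommRing A₂] [IsDomain A₂] [Algebra k A₂] [Algebra.FiniteType k A₂]
    (htr₁ : TrdegOne k A₁) (f : MvPolynomial σ A₁ ≃ₐ[k] MvPolynomial σ A₂) {a₀ : A₁}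
    (ha₀ : ∀ b, f (MvPolynomial.C a₀) ≠ MvPolynomial.C b) (p : Ideal A₁) [p.IsMaximal] {d : A₂}
    (hd : d ≠ 0) : ∃ α, MvPolynomial.coeff α (f.symm (MvPolynomial.C d)) ∉ p := by
  obtain ⟨χ, π, hπC, hχd, hπ⟩ := MvPolynomial.exists_specialization (k := k) ha₀ hd
  by_contra! h
  rw [← MvPolynomial.mem_map_C_iff] at h
  let ψ : A₁ →ₐ[k] k[X] :=
    (π.comp f.toAlgHom).comp (IsScalarTower.toAlgHom k A₁ (MvPolynomial σ A₁))
  have hinj : Function.Injective ψ :=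
    htr₁.injective_of_transcendental ψ (a := a₀) (Polynomial.transcendental_of_ne_C hπ)
  algebraize [ψ.toRingHom]
  have : IsScalarTower k A₁ k[X] := .of_algHom ψ
  have := Polynomial.isIntegral_of_ne_C (k := k) (A := A₁) hπ
  obtain ⟨Q, hQ, hQp⟩ := Ideal.exists_ideal_over_maximal_of_isIntegral (S := k[X]) p
    ((RingHom.injective_iff_ker_eq_bot _).1 hinj ▸ bot_le)
  have hmem := Ideal.mem_map_of_mem (π.comp f.toAlgHom).toRingHom h
  rw [Ideal.map_map] at hmem
  have hle : Ideal.map ((π.comp f.toAlgHom).toRingHom.comp MvPolynomial.C) p ≤ Q :=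
    Ideal.map_le_iff_le_comap.2 hQp.ge
  have hχ : (π.comp f.toAlgHom).toRingHom (f.symm (MvPolynomial.C d)) = Polynomial.C (χ d) := by
    simp [← hπC]
  exact hQ.ne_top (Ideal.eq_top_of_isUnit_mem _ (hχ ▸ hle hmem)
    (Polynomial.isUnit_C.2 (isUnit_iff_ne_zero.2 hχd)))

theorem isIntegrallyClosed_of_ne_C {k A₁ A₂ σ : Type*} [Field k] [IsAlgClosed k]
    [CommRing A₁] [IsDomain A₁] [Algebra k A₁]
    [CommRing A₂] [IsDomain A₂] [Algebra k A₂] [Algebra.FiniteType k A₂]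
    (htr₁ : TrdegOne k A₁) (f : MvPolynomial σ A₁ ≃ₐ[k] MvPolynomial σ A₂) {a₀ : A₁}
    (ha₀ : ∀ b, f (MvPolynomial.C a₀) ≠ MvPolynomial.C b) : IsIntegrallyClosed A₁ := by
  let ι : MvPolynomial σ A₂ →+* MvPolynomial σ (FractionRing A₂) :=
    MvPolynomial.map (algebraMap A₂ (FractionRing A₂))
  have hι : Function.Injective ι := MvPolynomial.map_injective _ (IsFractionRing.injective _ _)
  let j : A₁ →+* MvPolynomial σ (FractionRing A₂) :=
    (ι.comp (f : MvPolynomial σ A₁ →+* MvPolynomial σ A₂)).comp MvPolynomial.C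
  refine .of_dvd_of_map_dvd j ((hι.comp f.injective).comp (MvPolynomial.C_injective _ _)) ?_
  rintro a b ⟨w, hw⟩
  let : Algebra (MvPolynomial σ A₂) (MvPolynomial σ (FractionRing A₂)) :=
    MvPolynomial.algebraMvPolynomial
  obtain ⟨⟨v, ⟨_, d, hd, rfl⟩⟩, hv⟩ := IsLocalization.surj
    (Submonoid.map (MvPolynomial.C (σ := σ)) (nonZeroDivisors A₂)) w
  have hfv : ι (f (MvPolynomial.C b) * v) = ι (f (MvPolynomial.C a) * MvPolynomial.C d) := by
    have h1 : w * ι (MvPolynomial.C d) = ι v := hv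
    have h2 : ι (f (MvPolynomial.C a)) = ι (f (MvPolynomial.C b)) * w := hw
    rw [map_mul, map_mul, ← h1, h2, mul_assoc]
  have key := congrArg f.symm (hι hfv)
  rw [map_mul, map_mul, f.symm_apply_apply, f.symm_apply_apply] at key
  by_contra hab
  let I : Ideal A₁ := Submodule.comap (LinearMap.mulLeft A₁ a) (Ideal.span {b})
  have hI : I ≠ ⊤ := fun h => hab <| Ideal.mem_span_singleton.1 <| by
    simpa [I] using (Ideal.eq_top_iff_one I).1 h
  obtain ⟨p, hp, hIp⟩ := Ideal.exists_le_maximal I hI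
  obtain ⟨α, hα⟩ := exists_coeff_symm_C_notMem htr₁ f ha₀ p (nonZeroDivisors.ne_zero hd)
  refine hα (hIp ?_)
  have := congrArg (MvPolynomial.coeff α) key
  rw [MvPolynomial.coeff_C_mul, MvPolynomial.coeff_C_mul] at this
  exact Ideal.mem_span_singleton.2 ⟨_, this.symm⟩

theorem nonempty_algEquiv_polynomial_of_ne_C {k A₁ A₂ σ : Type*} [Field k] [IsAlgClosed k]
    [CommRing A₁] [IsDomain A₁] [Algebra k A₁]
    [CommRing A₂] [IsDomain A₂] [Algebra k A₂] [Algebra.FiniteType k A₂]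
    (htr₁ : TrdegOne k A₁) (f : MvPolynomial σ A₁ ≃ₐ[k] MvPolynomial σ A₂) {a₀ : A₁}
    (ha₀ : ∀ b, f (MvPolynomial.C a₀) ≠ MvPolynomial.C b) : Nonempty (A₁ ≃ₐ[k] k[X]) := by
  have := isIntegrallyClosed_of_ne_C htr₁ f ha₀
  obtain ⟨-, π, -, -, hπ⟩ := MvPolynomial.exists_specialization (k := k) ha₀ one_ne_zero
  let ψ : A₁ →ₐ[k] k[X] :=
    (π.comp f.toAlgHom).comp (IsScalarTower.toAlgHom k A₁ (MvPolynomial σ A₁))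
  have hinj : Function.Injective ψ :=
    htr₁.injective_of_transcendental ψ (a := a₀) (Polynomial.transcendental_of_ne_C hπ)
  algebraize [ψ.toRingHom]
  have : IsScalarTower k A₁ k[X] := .of_algHom ψ
  have : FaithfulSMul A₁ k[X] := (faithfulSMul_iff_algebraMap_injective _ _).2 hinj
  have := Polynomial.isIntegral_of_ne_C (k := k) (A := A₁) hπ
  exact nonempty_algEquiv_polynomial

theorem symm_C_eq_C {k A₁ A₂ σ : Type*} [Field k]
    [CommRing A₁] [IsDomain A₁] [Algebra k A₁] [CommRing A₂] [IsDomain A₂] [Algebra k A₂]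
    (htr₁ : TrdegOne k A₁) (htr₂ : TrdegOne k A₂)
    (f : MvPolynomial σ A₁ ≃ₐ[k] MvPolynomial σ A₂)
    (hf : ∀ a, ∃ b, f (MvPolynomial.C a) = MvPolynomial.C b) (b : A₂) :
    ∃ a, f.symm (MvPolynomial.C b) = MvPolynomial.C a := by
  obtain ⟨x, hx⟩ := htr₁
  have hx : Transcendental k x := algebraicIndependent_unique_type_iff.1 hx.1
  obtain ⟨y, hy⟩ := hf x
  let C₁ : A₁ →ₐ[k] MvPolynomial σ A₁ := IsScalarTower.toAlgHom k A₁ _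
  let C₂ : A₂ →ₐ[k] MvPolynomial σ A₂ := IsScalarTower.toAlgHom k A₂ _
  let g : A₂ →ₐ[k] MvPolynomial σ A₁ := f.symm.toAlgHom.comp C₂
  have hC₁ : Function.Injective C₁ := MvPolynomial.C_injective _ _
  have hC₂ : Function.Injective C₂ := MvPolynomial.C_injective _ _
  have hg : Function.Injective g := f.symm.injective.comp hC₂
  have hgy : g y = C₁ x := (congrArg f.symm hy.symm).trans (f.symm_apply_apply _)
  have hy : Transcendental k y := by
    rwa [Transcendental, ← isAlgebraic_algHom_iff g hg, hgy, isAlgebraic_algHom_iff C₁ hC₁]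
  have := htr₂.isAlgebraic_adjoin hy
  let τ : Algebra.adjoin k {y} →+* A₁ :=
    (MvPolynomial.constantCoeff.comp (g : A₂ →+* MvPolynomial σ A₁)).comp
      (Algebra.adjoin k {y}).val.toRingHom
  have hτ (s : Algebra.adjoin k {y}) : MvPolynomial.C (τ s) = g s := by
    have hs : (s : A₂) ∈ C₁.range.comap g :=
      Algebra.adjoin_le (by simpa using ⟨x, hgy.symm⟩) s.2
    obtain ⟨r, hr⟩ := hs
    change MvPolynomial.C (MvPolynomial.constantCoeff (g s)) = g s
    have hr : MvPolynomial.C r = g s := hr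
    rw [← hr, MvPolynomial.constantCoeff_C]
  refine MvPolynomial.eq_C_of_isAlgebraic
    ((Algebra.IsAlgebraic.isAlgebraic (R := Algebra.adjoin k {y}) b).ringHom_of_comp_eq τ
      (g : A₂ →+* MvPolynomial σ A₁) ?_ (RingHom.ext hτ))
  intro s t hst
  exact Subtype.ext (hg (by rw [← hτ, ← hτ, hst]))

theorem map_range_C_eq_range_C {k A₁ A₂ σ : Type*} [Field k] [IsAlgClosed k]
    [CommRing A₁] [IsDomain A₁] [Algebra k A₁]
    [CommRing A₂] [IsDomain A₂] [Algebra k A₂] [Algebra.FiniteType k A₂]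
    (htr₁ : TrdegOne k A₁) (htr₂ : TrdegOne k A₂)
    (f : MvPolynomial σ A₁ ≃ₐ[k] MvPolynomial σ A₂) (hA₁ : IsEmpty (A₁ ≃ₐ[k] k[X])) :
    Subalgebra.map f.toAlgHom (IsScalarTower.toAlgHom k A₁ (MvPolynomial σ A₁)).range =
      (IsScalarTower.toAlgHom k A₂ (MvPolynomial σ A₂)).range := by
  have hf (a : A₁) : ∃ b, f (MvPolynomial.C a) = MvPolynomial.C b := by
    by_contra! h
    exact not_nonempty_iff.2 hA₁ (nonempty_algEquiv_polynomial_of_ne_C htr₁ f h)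
  apply le_antisymm
  · rintro _ ⟨_, ⟨a, rfl⟩, rfl⟩
    obtain ⟨b, hb⟩ := hf a
    exact ⟨b, hb.symm⟩
  · rintro _ ⟨b, rfl⟩
    obtain ⟨a, ha⟩ := symm_C_eq_C htr₁ htr₂ f hf b
    exact ⟨_, ⟨a, rfl⟩, by
      change f (MvPolynomial.C a) = MvPolynomial.C b
      rw [← ha, f.apply_symm_apply]⟩

theorem nonempty_algEquiv_of_isEmpty {k A₁ A₂ σ : Type*} [Field k] [IsAlgClosed k]
    [CommRing A₁] [IsDomain A₁] [Algebra k A₁]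
    [CommRing A₂] [IsDomain A₂] [Algebra k A₂] [Algebra.FiniteType k A₂]
    (htr₁ : TrdegOne k A₁) (htr₂ : TrdegOne k A₂)
    (f : MvPolynomial σ A₁ ≃ₐ[k] MvPolynomial σ A₂) (hA₁ : IsEmpty (A₁ ≃ₐ[k] k[X])) :
    Nonempty (A₁ ≃ₐ[k] A₂) :=
  ⟨(AlgEquiv.ofInjective (IsScalarTower.toAlgHom k A₁ (MvPolynomial σ A₁))
      (MvPolynomial.C_injective _ _)).trans <|
    (f.subalgebraMap _).trans <|
    (Subalgebra.equivOfEq _ _ (map_range_C_eq_range_C htr₁ htr₂ f hA₁)).trans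
    (AlgEquiv.ofInjective (IsScalarTower.toAlgHom k A₂ (MvPolynomial σ A₂))
      (MvPolynomial.C_injective _ _)).symm⟩

/-- **Corollary (Abhyankar–Eakin–Heinzer).** Cancellation of polynomial rings over curves,
together with the statement that when `A₁ ≇ k[X]` any isomorphism of the polynomial rings
restricts to an isomorphism of `A₁` onto `A₂` (constants map onto constants). -/
theorem abhyankar_eakin_heinzer
    {k A₁ A₂ : Type*} [Field k] [IsAlgClosed k]
    [CommRing A₁] [IsDomain A₁] [Algebra k A₁] [Algebra.FiniteType k A₁]
    [CommRing A₂] [IsDomain A₂] [Algebra k A₂] [Algebra.FiniteType k A₂]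
    (htr₁ : TrdegOne k A₁) (htr₂ : TrdegOne k A₂) (n : ℕ) (hn : 0 < n) :
    (Nonempty ((MvPolynomial (Fin n) A₁) ≃ₐ[k] (MvPolynomial (Fin n) A₂)) →
      Nonempty (A₁ ≃ₐ[k] A₂)) ∧
    (∀ f : (MvPolynomial (Fin n) A₁) ≃ₐ[k] (MvPolynomial (Fin n) A₂),
      IsEmpty (A₁ ≃ₐ[k] Polynomial k) →
      Subalgebra.map f.toAlgHom
          (IsScalarTower.toAlgHom k A₁ (MvPolynomial (Fin n) A₁)).range =
        (IsScalarTower.toAlgHom k A₂ (MvPolynomial (Fin n) A₂)).range) := by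
  refine ⟨fun ⟨f⟩ => ?_, fun f hA₁ => map_range_C_eq_range_C htr₁ htr₂ f hA₁⟩
  rcases isEmpty_or_nonempty (A₁ ≃ₐ[k] k[X]) with h₁ | ⟨⟨e₁⟩⟩
  · exact nonempty_algEquiv_of_isEmpty htr₁ htr₂ f h₁
  rcases isEmpty_or_nonempty (A₂ ≃ₐ[k] k[X]) with h₂ | ⟨⟨e₂⟩⟩
  · exact (nonempty_algEquiv_of_isEmpty htr₂ htr₁ f.symm h₂).map AlgEquiv.symm
  · exact ⟨e₁.trans e₂.symm⟩
end

section
/- Let k be an algebraically closed field and let A be an integral domain that is a k-algebra with trdeg_k(A) = 1. Then AK(A) = k if and only if A is isomorphic as a k-algebra to the polynomial ring k[X]; and if A is not isomorphic to k[X], then AK(A) = A (that is, A is rigid). -/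
open Polynomial TensorProduct

lemma dvd_of_choose_cast_eq_zero (R : Type*) [CommRing R] [Nontrivial R] {n m : ℕ} (hn0 : 0 < n)
    (hn : ∀ j, 0 < j → j < n → (n.choose j : R) = 0)
    (hm : ∀ j, 0 < j → j < n → (m.choose j : R) = 0) : n ∣ m := by
  by_contra hd
  have hr0 : 0 < m % n := Nat.pos_of_ne_zero fun h => hd (Nat.dvd_of_mod_eq_zero h)
  have hrn : m % n < n := Nat.mod_lt _ hn0
  have hfrob : ((X + 1 : R[X])) ^ n = X ^ n + 1 := by
    ext j
    rw [coeff_X_add_one_pow, coeff_add, coeff_X_pow, coeff_one]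
    rcases Nat.eq_zero_or_pos j with rfl | hj
    · simp [hn0.ne]
    · rcases lt_trichotomy j n with h | rfl | h
      · simp [hn j hj h, h.ne, hj.ne']
      · simp [hj.ne']
      · simp [Nat.choose_eq_zero_of_lt h, h.ne', hj.ne']
  obtain ⟨g, hg⟩ : (X ^ n : R[X]) ∣ (X ^ n + 1) ^ (m / n) - 1 := by
    have h := sub_dvd_pow_sub_pow (X ^ n + 1 : R[X]) 1 (m / n)
    rwa [one_pow, show (X ^ n + 1 - 1 : R[X]) = X ^ n by ring] at h
  have hsplit : (X + 1 : R[X]) ^ m = X ^ n * (g * (X + 1) ^ (m % n)) + (X + 1) ^ (m % n) := by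
    conv_lhs => rw [← Nat.div_add_mod m n, pow_add, pow_mul, hfrob, eq_add_of_sub_eq hg]
    ring
  have hc := congrArg (fun p => coeff p (m % n)) hsplit
  simp [coeff_X_add_one_pow, coeff_X_pow_mul', hm _ hr0 hrn, hrn.not_ge] at hc

lemma eval₂_C_comp_C_eq_taylor {A : Type*} [CommRing A] (p : A[X]) :
    p.eval₂ ((C : A[X] →+* A[X][X]).comp (C : A →+* A[X])) (X + C X) = taylor X (p.map C) := by
  rw [taylor_apply, comp, eval₂_map]

section Exponential

variable {k A : Type*} [CommRing k] [CommRing A] [Algebra k A] {φ : A →ₐ[k] A[X]}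

lemma mem_expInvariants {a : A} : a ∈ expInvariants φ ↔ φ a = C a := by
  rfl

lemma IsExponential.mem_expInvariants_iff (hφ : IsExponential φ) {a : A} :
    a ∈ expInvariants φ ↔ (φ a).natDegree = 0 := by
  rw [mem_expInvariants]
  refine ⟨fun h => by simp [h], fun h => ?_⟩
  have h0 := hφ.1 a
  rw [eq_C_of_natDegree_eq_zero h, eval_C] at h0
  rw [eq_C_of_natDegree_eq_zero h, h0]

lemma IsExponential.map_coeff (hφ : IsExponential φ) (a : A) (i : ℕ) :
    φ ((φ a).coeff i) = hasseDeriv i (φ a) := by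
  have h := congrArg (fun p => coeff p i) (hφ.2 a)
  have hmap : hasseDeriv i ((φ a).map C) = (hasseDeriv i (φ a)).map C := by
    ext1 j
    simp [hasseDeriv_coeff]
  simpa [eval₂_C_comp_C_eq_taylor, taylor_coeff, hmap, eval_map, eval₂_C_X] using h

lemma IsExponential.leadingCoeff_mem (hφ : IsExponential φ) (a : A) :
    (φ a).leadingCoeff ∈ expInvariants φ := by
  rw [mem_expInvariants, leadingCoeff, hφ.map_coeff, hasseDeriv_natDegree_eq_C, leadingCoeff]

lemma IsExponential.exists_natDegree_eq [IsDomain A] (hφ : IsExponential φ) (a : A) {j : ℕ}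
    (hj : 0 < j) (hc : ((φ a).natDegree.choose j : A) ≠ 0) : ∃ b, (φ b).natDegree = j := by
  have hjm : j ≤ (φ a).natDegree := by
    by_contra h
    exact hc (by rw [Nat.choose_eq_zero_of_lt (not_le.mp h), Nat.cast_zero])
  have ha : φ a ≠ 0 := by
    intro h
    rw [h, natDegree_zero] at hjm
    omega
  refine ⟨(φ a).coeff ((φ a).natDegree - j), ?_⟩
  rw [hφ.map_coeff]
  refine natDegree_eq_of_le_of_coeff_ne_zero ?_ ?_
  · exact (natDegree_hasseDeriv_le _ _).trans (by omega)
  · rw [hasseDeriv_coeff, Nat.add_sub_cancel' hjm, Nat.choose_symm hjm]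
    exact mul_ne_zero hc (leadingCoeff_ne_zero.mpr ha)

lemma IsExponential.natDegree_dvd [IsDomain A] (hφ : IsExponential φ) {x : A}
    (hx : 0 < (φ x).natDegree)
    (hmin : ∀ a, 0 < (φ a).natDegree → (φ x).natDegree ≤ (φ a).natDegree) (a : A) :
    (φ x).natDegree ∣ (φ a).natDegree := by
  have key : ∀ b j, 0 < j → j < (φ x).natDegree → ((φ b).natDegree.choose j : A) = 0 := by
    intro b j hj hjx
    by_contra hc
    obtain ⟨c, rfl⟩ := hφ.exists_natDegree_eq b hj hc
    exact hjx.not_ge (hmin c hj)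
  exact dvd_of_choose_cast_eq_zero A hx (key x) (key a)

/-- The ring of invariants is algebraically closed in `A`. -/
lemma IsExponential.mem_expInvariants_of_isAlgebraic [IsDomain A] (hφ : IsExponential φ)
    {a : A} (ha : IsAlgebraic (expInvariants φ) a) : a ∈ expInvariants φ := by
  obtain ⟨F, hF0, hF⟩ := ha
  have hinj : Function.Injective (algebraMap (expInvariants φ) A) := Subtype.val_injective
  have hcomp : (F.map (algebraMap (expInvariants φ) A)).comp (φ a) = 0 := by
    have h := congrArg φ hF
    rw [map_zero, aeval_def, ← AlgHom.coe_toRingHom, hom_eval₂] at h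
    have hc : (φ : A →+* A[X]).comp (algebraMap (expInvariants φ) A) =
        C.comp (algebraMap (expInvariants φ) A) := by
      ext1 b
      exact b.2
    rw [comp, eval₂_map, ← hc]
    exact h
  have hF0' : F.map (algebraMap (expInvariants φ) A) ≠ 0 :=
    (Polynomial.map_ne_zero_iff hinj).mpr hF0
  rw [hφ.mem_expInvariants_iff]
  by_contra hdeg
  rcases comp_eq_zero_iff.mp hcomp with h | ⟨_, h⟩
  · exact hF0' h
  · exact hdeg (by rw [h, natDegree_C])

end Exponential

lemma TrdegOne.exists_transcendental {k A : Type*} [Field k] [CommRing A] [Algebra k A]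
    (htr : TrdegOne k A) : ∃ x : A, Transcendental k x := by
  obtain ⟨x, hx⟩ := htr
  exact ⟨x, algebraicIndependent_unique_type_iff.mp hx.1⟩

section TrdegOne

variable {k A : Type*} [Field k] [CommRing A] [IsDomain A] [Algebra k A]

lemma TrdegOne.isAlgebraic_adjoin_s9 (htr : TrdegOne k A) {y : A} (hy : Transcendental k y) (a : A) :
    IsAlgebraic (Algebra.adjoin k {y}) a := by
  obtain ⟨x, hx⟩ := htr
  have hy' : AlgebraicIndependent k (fun _ : Unit => y) :=
    algebraicIndependent_unique_type_iff.mpr hy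
  have hb : IsTranscendenceBasis k (fun _ : Unit => y) := by
    refine hy'.isTranscendenceBasis_of_lift_trdeg_le_of_finite ?_
    rw [← hx.lift_cardinalMk_eq_trdeg]
  have := hb.isAlgebraic.isAlgebraic a
  rwa [Set.range_const] at this

variable [IsAlgClosed k]

lemma IsAlgClosed.mem_bot_of_isAlgebraic {a : A} (ha : IsAlgebraic k a) :
    a ∈ (⊥ : Subalgebra k A) := by
  rw [Algebra.mem_bot]
  exact minpoly.mem_range_of_degree_eq_one k a
    (IsAlgClosed.degree_eq_one_of_irreducible k (minpoly.irreducible ha.isIntegral))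

variable {φ : A →ₐ[k] A[X]}

lemma IsExponential.expInvariants_eq_bot (htr : TrdegOne k A) (hφ : IsExponential φ)
    (hne : expInvariants φ ≠ ⊤) : expInvariants φ = ⊥ := by
  refine eq_bot_iff.mpr fun y hy => ?_
  by_contra hybot
  have hyt : Transcendental k y := fun h => hybot (IsAlgClosed.mem_bot_of_isAlgebraic h)
  refine hne (eq_top_iff.mpr fun a _ => hφ.mem_expInvariants_of_isAlgebraic ?_)
  have hle : Algebra.adjoin k {y} ≤ expInvariants φ :=
    Algebra.adjoin_le (Set.singleton_subset_iff.mpr hy)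
  obtain ⟨F, hF0, hF⟩ := htr.isAlgebraic_adjoin_s9 hyt a
  refine ⟨F.map (Subalgebra.inclusion hle).toRingHom,
    (Polynomial.map_ne_zero_iff (Subalgebra.inclusion_injective hle)).mpr hF0, ?_⟩
  rw [aeval_def, eval₂_map]
  exact hF

lemma IsExponential.nonempty_algEquiv_polynomial (htr : TrdegOne k A) (hφ : IsExponential φ)
    (hne : expInvariants φ ≠ ⊤) : Nonempty (A ≃ₐ[k] k[X]) := by
  classical
  have hbot := hφ.expInvariants_eq_bot htr hne
  have hex : ∃ n, 0 < n ∧ ∃ x, (φ x).natDegree = n := by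
    by_contra! h
    refine hne (eq_top_iff.mpr fun a _ => hφ.mem_expInvariants_iff.mpr ?_)
    by_contra h0
    exact h _ (Nat.pos_of_ne_zero h0) a rfl
  obtain ⟨hn0, x, hxn⟩ := Nat.find_spec hex
  have hmin : ∀ a, 0 < (φ a).natDegree → (φ x).natDegree ≤ (φ a).natDegree := fun a ha =>
    hxn.trans_le (Nat.find_min' hex ⟨ha, a, rfl⟩)
  have hx0 : 0 < (φ x).natDegree := hxn ▸ hn0
  have hxne : φ x ≠ 0 := fun h => by simp [h] at hx0
  have hlead : ∀ a, ∃ c : k, algebraMap k A c = (φ a).leadingCoeff := fun a => by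
    simpa [hbot, Algebra.mem_bot] using hφ.leadingCoeff_mem a
  have hxt : Transcendental k x := by
    intro h
    have : x ∈ expInvariants φ := hbot ▸ IsAlgClosed.mem_bot_of_isAlgebraic h
    exact hx0.ne' (hφ.mem_expInvariants_iff.mp this)
  have hsurj : ∀ n, ∀ a, (φ a).natDegree = n → a ∈ (aeval (R := k) x).range := by
    intro n
    induction n using Nat.strong_induction_on with
    | _ n ih =>
      intro a ha
      rcases Nat.eq_zero_or_pos n with rfl | hn
      · have hmem := hφ.mem_expInvariants_iff.mpr ha
        rw [hbot] at hmem
        exact bot_le (a := (aeval (R := k) x).range) hmem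
      · obtain ⟨q, hq⟩ := hφ.natDegree_dvd hx0 hmin a
        obtain ⟨c, hc⟩ := hlead a
        obtain ⟨d, hd⟩ := hlead x
        have hd0 : d ≠ 0 := by
          rintro rfl
          exact hxne (leadingCoeff_eq_zero.mp (by rw [← hd, map_zero]))
        have ha0 : φ a ≠ 0 := fun h => by simp [h] at ha; omega
        have hc0 : c ≠ 0 := by
          rintro rfl
          exact ha0 (leadingCoeff_eq_zero.mp (by rw [← hc, map_zero]))
        set e : k := c / d ^ q with he
        have he0 : e ≠ 0 := div_ne_zero hc0 (pow_ne_zero _ hd0)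
        set b : A := algebraMap k A e * x ^ q with hb
        have hφb : φ b = C (algebraMap k A e) * (φ x) ^ q := by
          rw [hb, map_mul, map_pow, AlgHom.commutes]
          rfl
        have hbr : b ∈ (aeval (R := k) x).range := ⟨C e * X ^ q, by simp [hb]⟩
        have heA : algebraMap k A e ≠ 0 := by
          simpa using he0
        have hdeg : (φ b).natDegree = (φ a).natDegree := by
          rw [hφb, natDegree_C_mul heA, natDegree_pow, hq, mul_comm]
        have hlc : (φ b).leadingCoeff = (φ a).leadingCoeff := by
          rw [hφb, leadingCoeff_mul, leadingCoeff_C, leadingCoeff_pow, ← hd, ← hc, ← map_pow,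
            ← map_mul, he, div_mul_cancel₀ _ (pow_ne_zero _ hd0)]
        have hlt : (φ (a - b)).natDegree < n := by
          rw [map_sub, ← ha]
          by_cases hz : φ a - φ b = 0
          · rw [hz, natDegree_zero]
            omega
          · refine natDegree_lt_natDegree hz (degree_sub_lt_left ?_ ha0 hlc.symm)
            rw [degree_eq_natDegree ha0, degree_eq_natDegree, hdeg]
            exact leadingCoeff_ne_zero.mp (hlc ▸ leadingCoeff_ne_zero.mpr ha0)
        simpa using add_mem (ih _ hlt (a - b) rfl) hbr
  exact ⟨(AlgEquiv.ofBijective (aeval (R := k) x)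
    ⟨transcendental_iff_injective.mp hxt, fun a => hsurj _ a rfl⟩).symm⟩

end TrdegOne

/-- The exponential map `X ↦ X + t`, transported to any algebra isomorphic to `k[X]`. -/
noncomputable def translationExp {k A : Type*} [CommRing k] [CommRing A] [Algebra k A]
    (e : A ≃ₐ[k] k[X]) : A →ₐ[k] A[X] :=
  (aeval (C (e.symm X) + X : A[X])).comp (e : A →ₐ[k] k[X])

section Translation

variable {k A : Type*} [CommRing k] [CommRing A] [Algebra k A] (e : A ≃ₐ[k] k[X])

lemma translationExp_symm_X : translationExp e (e.symm X) = C (e.symm X) + X := by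
  simp [translationExp]

lemma algHom_ext_symm_X {B : Type*} [CommRing B] [Algebra k B] {f g : A →ₐ[k] B}
    (h : f (e.symm X) = g (e.symm X)) : f = g := by
  have : f.comp (e.symm : k[X] →ₐ[k] A) = g.comp (e.symm : k[X] →ₐ[k] A) :=
    Polynomial.algHom_ext h
  ext a
  simpa using DFunLike.congr_fun this (e a)

lemma isExponential_translationExp : IsExponential (translationExp e) := by
  set φ := translationExp e
  have hX : φ (e.symm X) = C (e.symm X) + X := translationExp_symm_X e
  constructor
  · intro a
    have h : ((aeval (R := A) (0 : A)).restrictScalars k).comp φ = AlgHom.id k A :=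
      algHom_ext_symm_X e (by simp [hX])
    simpa [coe_aeval_eq_eval] using DFunLike.congr_fun h a
  · intro a
    have h : (mapAlgHom φ).comp φ =
        (((taylorAlgHom (X : A[X])).restrictScalars k).comp (mapAlgHom CAlgHom)).comp φ :=
      algHom_ext_symm_X e (by simp [hX, add_comm, add_left_comm])
    rw [eval₂_C_comp_C_eq_taylor]
    exact DFunLike.congr_fun h a

lemma expInvariants_translationExp_ne_top [Nontrivial A] :
    expInvariants (translationExp e) ≠ ⊤ := by
  intro h
  have hX : e.symm X ∈ expInvariants (translationExp e) := h ▸ Algebra.mem_top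
  rw [mem_expInvariants, translationExp_symm_X] at hX
  simp at hX

end Translation

/-- **Lemma 3.** For a domain `A` of transcendence degree 1 over an algebraically closed
field `k`: `AK(A) = k` iff `A ≅ k[X]`, and otherwise `AK(A) = A` (i.e. `A` is rigid). -/
theorem ak_of_dim_one_domain
    {k A : Type*} [Field k] [IsAlgClosed k]
    [CommRing A] [IsDomain A] [Algebra k A] (htr : TrdegOne k A) :
    (AK k A = ⊥ ↔ Nonempty (A ≃ₐ[k] Polynomial k)) ∧
    (IsEmpty (A ≃ₐ[k] Polynomial k) → AK k A = ⊤) := by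
  have hAK : (∃ φ : A →ₐ[k] A[X], IsExponential φ ∧ expInvariants φ ≠ ⊤) ∨ AK k A = ⊤ := by
    by_contra! h
    exact h.2 (iInf_eq_top.mpr fun φ => h.1 φ.1 φ.2)
  refine ⟨⟨fun hbot => ?_, fun ⟨e⟩ => ?_⟩, fun hempty => ?_⟩
  · rcases hAK with ⟨φ, hφ, hne⟩ | htop
    · exact hφ.nonempty_algEquiv_polynomial htr hne
    · obtain ⟨x, hx⟩ := htr.exists_transcendental
      have hx' : x ∈ (⊥ : Subalgebra k A) := by
        rw [← hbot, htop]
        exact Algebra.mem_top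
      obtain ⟨c, rfl⟩ := Algebra.mem_bot.mp hx'
      exact absurd (isAlgebraic_algebraMap c) hx
  · refine eq_bot_iff.mpr ?_
    rw [← (isExponential_translationExp e).expInvariants_eq_bot htr
      (expInvariants_translationExp_ne_top e)]
    exact iInf_le (fun φ : {ψ : A →ₐ[k] A[X] // IsExponential ψ} => expInvariants φ.1)
      ⟨_, isExponential_translationExp e⟩
  · exact hAK.resolve_left fun ⟨φ, hφ, hne⟩ =>
      hempty.elim (hφ.nonempty_algEquiv_polynomial htr hne).some
end

section
/- Let k be an algebraically closed field, let A be an affine domain over k, and let B be an integral domain that is a k-algebra (so that A ⊗_k B is a domain). If the image of A in A ⊗_k B is contained in AK(A ⊗_k B), then AK(A ⊗_k B) equals the canonical image of AK(A) ⊗_k AK(B) in A ⊗_k B. -/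
open Polynomial TensorProduct

theorem mem_AK_iff {k R : Type*} [CommRing k] [CommRing R] [Algebra k R] {r : R} :
    r ∈ AK k R ↔ ∀ φ : R →ₐ[k] R[X], IsExponential φ → φ r = C r := by
  simp only [AK, Algebra.mem_iInf, Subtype.forall]
  rfl

theorem isExponential_CAlgHom {k R : Type*} [CommRing k] [CommRing R] [Algebra k R] :
    IsExponential (CAlgHom : R →ₐ[k] R[X]) :=
  ⟨fun a => by simp, fun a => by simp⟩

/-- A compatibility with algebra maps `f : R → S` transports the coaction identity at `r`
to the coaction identity at `f r`. -/
theorem coaction_identity_map {k R S : Type*} [CommRing k] [CommRing R] [Algebra k R]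
    [CommRing S] [Algebra k S] (f : R →ₐ[k] S) {φ : R →ₐ[k] R[X]} {ψ : S →ₐ[k] S[X]}
    (hf : ψ.comp f = (mapAlgHom f).comp φ) {r : R}
    (hr : (φ r).map (φ : R →+* R[X]) =
      (φ r).eval₂ ((C : R[X] →+* R[X][X]).comp (C : R →+* R[X])) (X + C X)) :
    (ψ (f r)).map (ψ : S →+* S[X]) =
      (ψ (f r)).eval₂ ((C : S[X] →+* S[X][X]).comp (C : S →+* S[X])) (X + C X) := by
  have hfr : ψ (f r) = (φ r).map (f : R →+* S) := DFunLike.congr_fun hf r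
  have hcomp : (ψ : S →+* S[X]).comp (f : R →+* S) =
      (mapRingHom (f : R →+* S)).comp (φ : R →+* R[X]) :=
    RingHom.ext fun x => DFunLike.congr_fun hf x
  have key := congrArg (Polynomial.map (mapRingHom (f : R →+* S))) hr
  rw [Polynomial.map_map, ← hcomp, ← Polynomial.map_map, ← hfr] at key
  rw [key, hfr, eval₂_map, ← coe_mapRingHom, hom_eval₂]
  congr 1
  · ext x; simp
  · simp

/-- The exponential map on `A ⊗ B` determined by maps on `A` and on `B`. -/
noncomputable def tensorExp {k A B : Type*} [CommRing k] [CommRing A] [Algebra k A]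
    [CommRing B] [Algebra k B] (φ : A →ₐ[k] A[X]) (ψ : B →ₐ[k] B[X]) :
    A ⊗[k] B →ₐ[k] (A ⊗[k] B)[X] :=
  Algebra.TensorProduct.lift
    ((mapAlgHom Algebra.TensorProduct.includeLeft).comp φ)
    ((mapAlgHom Algebra.TensorProduct.includeRight).comp ψ)
    fun _ _ => Commute.all _ _

section TensorExp

variable {k A B : Type*} [CommRing k] [CommRing A] [Algebra k A] [CommRing B] [Algebra k B]
  {φ : A →ₐ[k] A[X]} {ψ : B →ₐ[k] B[X]}

theorem tensorExp_comp_includeLeft :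
    (tensorExp φ ψ).comp Algebra.TensorProduct.includeLeft =
      (mapAlgHom Algebra.TensorProduct.includeLeft).comp φ :=
  Algebra.TensorProduct.lift_comp_includeLeft _ _ _

theorem tensorExp_comp_includeRight :
    (tensorExp φ ψ).comp Algebra.TensorProduct.includeRight =
      (mapAlgHom Algebra.TensorProduct.includeRight).comp ψ := by
  ext b
  simp [tensorExp]

theorem IsExponential.tensorExp (hφ : IsExponential φ) (hψ : IsExponential ψ) :
    IsExponential (tensorExp φ ψ) := by
  have hl (a : A) : _root_.tensorExp φ ψ (a ⊗ₜ 1) =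
      (φ a).map ((Algebra.TensorProduct.includeLeft : A →ₐ[k] A ⊗[k] B) : A →+* A ⊗[k] B) :=
    by simp [_root_.tensorExp]
  have hr (b : B) : _root_.tensorExp φ ψ (1 ⊗ₜ b) =
      (ψ b).map ((Algebra.TensorProduct.includeRight : B →ₐ[k] A ⊗[k] B) : B →+* A ⊗[k] B) :=
    by simp [_root_.tensorExp]
  refine ⟨fun x => ?_, fun x => ?_⟩
  · induction x with
    | zero => simp
    | add x y hx hy => rw [map_add, eval_add, hx, hy]
    | tmul a b =>
      have e : a ⊗ₜ[k] b = a ⊗ₜ 1 * 1 ⊗ₜ b := by simp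
      rw [e, map_mul, eval_mul, hl, hr, eval_zero_map, eval_zero_map, hφ.1, hψ.1]
      rfl
  · induction x with
    | zero => simp
    | add x y hx hy => rw [map_add, Polynomial.map_add, eval₂_add, hx, hy]
    | tmul a b =>
      have e : a ⊗ₜ[k] b = a ⊗ₜ 1 * 1 ⊗ₜ b := by simp
      have ha := coaction_identity_map _ (tensorExp_comp_includeLeft (ψ := ψ)) (hφ.2 a)
      have hb := coaction_identity_map _ (tensorExp_comp_includeRight (φ := φ)) (hψ.2 b)
      rw [Algebra.TensorProduct.includeLeft_apply] at ha
      rw [Algebra.TensorProduct.includeRight_apply] at hb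
      rw [e, map_mul, Polynomial.map_mul, eval₂_mul, ha, hb]

end TensorExp

theorem eq_zero_of_forall_algHom_eq_zero {k A : Type*} [Field k] [IsAlgClosed k] [CommRing A]
    [IsReduced A] [Algebra k A] [Algebra.FiniteType k A] {a : A}
    (h : ∀ ε : A →ₐ[k] k, ε a = 0) : a = 0 := by
  have : IsJacobsonRing A := isJacobsonRing_of_finiteType (A := k)
  have hJ : (⊥ : Ideal A).jacobson = ⊥ :=
    this.out fun x ⟨_, hx⟩ => eq_zero_of_pow_eq_zero hx
  rw [← Ideal.mem_bot, ← hJ, Ideal.jacobson, Ideal.mem_sInf]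
  rintro m ⟨-, hm⟩
  let := Ideal.Quotient.field m
  have : Module.Finite k (A ⧸ m) := finite_of_finite_type_of_isJacobsonRing k (A ⧸ m)
  let e : k ≃ₐ[k] A ⧸ m := AlgEquiv.ofBijective (Algebra.ofId k (A ⧸ m))
    (IsAlgClosed.algebraMap_bijective_of_isIntegral)
  have := h ((e.symm : A ⧸ m →ₐ[k] k).comp (Ideal.Quotient.mkₐ k m))
  rw [← Ideal.Quotient.eq_zero_iff_mem]
  simpa using this


/-- The invariants of the base change of an exponential map on `B` are detected on the slices
of a tensor by linear functionals on `A`. -/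
theorem slice_tensorExp {k A B : Type*} [CommRing k] [CommRing A] [Algebra k A]
    [CommRing B] [Algebra k B] (ψ : B →ₐ[k] B[X]) (g : A →ₗ[k] k) (x : A ⊗[k] B) (n : ℕ) :
    TensorProduct.lid k B (g.rTensor B ((tensorExp CAlgHom ψ x).coeff n)) =
      (ψ (TensorProduct.lid k B (g.rTensor B x))).coeff n := by
  induction x with
  | zero => simp
  | add x y hx hy => simp only [map_add, coeff_add, hx, hy]
  | tmul a b => simp [tensorExp, coeff_C_mul]

theorem AK_tensor_le_range_map {k A B : Type*} [Field k] [CommRing A] [Algebra k A]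
    [CommRing B] [Algebra k B] (hA : AK k A = ⊤) :
    AK k (A ⊗[k] B) ≤ (Algebra.TensorProduct.map (AK k A).val (AK k B).val).range := by
  classical
  intro x hx
  let e := Module.Basis.ofVectorSpace k A
  rw [← (TensorProduct.equivFinsuppOfBasisLeft (N := B) e).symm_apply_apply x,
    TensorProduct.equivFinsuppOfBasisLeft_symm_apply]
  refine sum_mem fun i _ => ?_
  have hb : TensorProduct.equivFinsuppOfBasisLeft (N := B) e x i ∈ AK k B := by
    rw [mem_AK_iff]
    intro ψ hψ
    rw [TensorProduct.equivFinsuppOfBasisLeft_apply]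
    ext n
    rw [← slice_tensorExp, mem_AK_iff.1 hx _ (isExponential_CAlgHom.tensorExp hψ)]
    simp only [coeff_C]
    split_ifs <;> simp
  exact ⟨(⟨e i, hA ▸ Algebra.mem_top⟩ : AK k A) ⊗ₜ ⟨_, hb⟩, rfl⟩

theorem AK_eq_top_of_range_includeLeft_le {k A B : Type*} [Field k] [CommRing A] [Algebra k A]
    [CommRing B] [Nontrivial B] [Algebra k B]
    (h : (Algebra.TensorProduct.includeLeft : A →ₐ[k] A ⊗[k] B).range ≤ AK k (A ⊗[k] B)) :
    AK k A = ⊤ := by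
  refine eq_top_iff.2 fun a _ => mem_AK_iff.2 fun φ hφ => ?_
  have h₁ := mem_AK_iff.1 (h ⟨a, rfl⟩) _ (hφ.tensorExp (isExponential_CAlgHom (R := B)))
  have h₂ := DFunLike.congr_fun
    (tensorExp_comp_includeLeft (φ := φ) (ψ := (CAlgHom : B →ₐ[k] B[X]))) a
  have hinj : Function.Injective (Algebra.TensorProduct.includeLeft : A →ₐ[k] A ⊗[k] B) :=
    Algebra.TensorProduct.includeLeft_injective (algebraMap k B).injective
  refine map_injective
    ((Algebra.TensorProduct.includeLeft : A →ₐ[k] A ⊗[k] B) : A →+* A ⊗[k] B) hinj ?_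
  rw [map_C]
  exact h₂.symm.trans h₁

/-- Specialization of `A ⊗ B` to `B` at a `k`-point of `A`. -/
noncomputable def tensorSpecialize {k A : Type*} (B : Type*) [CommRing k] [CommRing A]
    [Algebra k A] [CommRing B] [Algebra k B] (ε : A →ₐ[k] k) : A ⊗[k] B →ₐ[k] B :=
  Algebra.TensorProduct.lift ((Algebra.ofId k B).comp ε) (AlgHom.id k B)
    fun _ _ => Commute.all _ _

section Specialize

variable {k A B : Type*} [CommRing k] [CommRing A] [Algebra k A] [CommRing B] [Algebra k B]

@[simp]
theorem tensorSpecialize_tmul (ε : A →ₐ[k] k) (a : A) (b : B) :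
    tensorSpecialize B ε (a ⊗ₜ b) = ε a • b := by
  simp [tensorSpecialize, Algebra.ofId_apply, Algebra.smul_def]

/-- An exponential map on `A ⊗ B` fixing `A` specializes to an exponential map on `B`. -/
theorem IsExponential.specialize {φ : A ⊗[k] B →ₐ[k] (A ⊗[k] B)[X]} (hφ : IsExponential φ)
    (hA : ∀ a : A, φ (a ⊗ₜ 1) = C (a ⊗ₜ 1)) (ε : A →ₐ[k] k) :
    IsExponential (((mapAlgHom (tensorSpecialize B ε)).comp φ).comp
      Algebra.TensorProduct.includeRight) := by
  have hcomp : (((mapAlgHom (tensorSpecialize B ε)).comp φ).comp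
      Algebra.TensorProduct.includeRight).comp (tensorSpecialize B ε) =
      (mapAlgHom (tensorSpecialize B ε)).comp φ := by
    ext x : 2
    · simp [hA, Algebra.smul_def]
    · simp
  refine ⟨fun b => ?_, fun b => ?_⟩
  · simp [eval_zero_map, hφ.1]
  · have := coaction_identity_map _ hcomp (hφ.2 (1 ⊗ₜ b))
    rwa [tensorSpecialize_tmul, map_one, one_smul] at this

end Specialize

theorem eq_zero_of_forall_tensorSpecialize_eq_zero {k A B : Type*} [Field k] [IsAlgClosed k]
    [CommRing A] [IsReduced A] [Algebra k A] [Algebra.FiniteType k A] [CommRing B] [Algebra k B]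
    {x : A ⊗[k] B} (h : ∀ ε : A →ₐ[k] k, tensorSpecialize B ε x = 0) : x = 0 := by
  classical
  let e := Module.Basis.ofVectorSpace k B
  refine (TensorProduct.equivFinsuppOfBasisRight (M := A) e).map_eq_zero_iff.1 ?_
  ext i
  refine eq_zero_of_forall_algHom_eq_zero (k := k) fun ε => ?_
  have key (y : A ⊗[k] B) : ε (TensorProduct.equivFinsuppOfBasisRight e y i) =
      e.repr (tensorSpecialize B ε y) i := by
    induction y with
    | zero => simp
    | add y z hy hz => simp only [map_add, Finsupp.add_apply, hy, hz]
    | tmul a b => simp [mul_comm]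
  rw [key, h, map_zero, Finsupp.zero_apply]

/-- **Lemma 4.** If the image of `A` in `A ⊗ₖ B` is contained in `AK(A ⊗ₖ B)`, then
`AK(A ⊗ₖ B)` equals the canonical image of `AK(A) ⊗ₖ AK(B)`. -/
theorem ak_tensor_of_left_factor_invariant
    {k A B : Type*} [Field k] [IsAlgClosed k]
    [CommRing A] [IsDomain A] [Algebra k A] [Algebra.FiniteType k A]
    [CommRing B] [IsDomain B] [Algebra k B] [IsDomain (A ⊗[k] B)]
    (h : (Algebra.TensorProduct.includeLeft : A →ₐ[k] A ⊗[k] B).range ≤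
      AK k (A ⊗[k] B)) :
    AK k (A ⊗[k] B) =
      (Algebra.TensorProduct.map (AK k A).val (AK k B).val).range := by
  have hA := AK_eq_top_of_range_includeLeft_le h
  refine le_antisymm (AK_tensor_le_range_map hA) ?_
  rw [Algebra.TensorProduct.map_range, sup_le_iff]
  constructor
  · rintro _ ⟨a, rfl⟩
    exact h ⟨a, rfl⟩
  · rintro _ ⟨b, rfl⟩
    refine mem_AK_iff.2 fun φ hφ => ?_
    rw [← sub_eq_zero]
    ext n
    refine eq_zero_of_forall_tensorSpecialize_eq_zero fun ε => ?_
    have hb := mem_AK_iff.1 b.2 _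
      (hφ.specialize (fun a => mem_AK_iff.1 (h ⟨a, rfl⟩) φ hφ) ε)
    have hn := congrArg (fun p => coeff p n) hb
    simp only [AlgHom.comp_apply, coe_mapAlgHom, coeff_map] at hn
    rw [coeff_sub, map_sub, sub_eq_zero]
    refine hn.trans ?_
    simp only [coeff_C]
    split_ifs <;> simp
end
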